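/- arXiv:math-ph/0006032 — 2 statements merged into one kernel-verified Lean document; each statement's English description precedes it below -/
import Mathlib

section
/- Assume g(m) ≠ 0 for every integer m, and let q : ℕ × ℕ → ℂ be a nowhere-vanishing function satisfying the recursion relations q_{ℓ,k} · g(k−ℓ) = q_{ℓ−1,k} · g(−ℓ) for all ℓ ≥ 1, k ∈ ℕ, and q_{ℓ,k+1} · (δ₁−δ₂+η(−λ₁−λ₂+k)) = q_{ℓ,k} · g(k−ℓ) for all ℓ, k ∈ ℕ. Set v_{ℓ,k} := q_{ℓ,k} · Σ_{n=0}^k M^{k,ℓ}_n |ℓ+n, k−n⟩. Then for all ℓ, k ∈ ℕ: (i) ΔD v_{ℓ,k} = d^(1)_ℓ d^(2)_k v_{ℓ,k}; (ii) ΔB v_{ℓ,k} = η f^(1)_ℓ d^(2)_k · (g(2λ₂−ℓ)/g(k−ℓ)) · v_{ℓ+1,k} + η d^(1)_ℓ f^(2)_k · (g(−2λ₁+k)/g(k−ℓ)) · v_{ℓ,k+1}; (iii) ΔC v_{ℓ,k} = η e_ℓ d^(2)_k · (g(−ℓ)/g(k−ℓ)) · v_{ℓ−1,k} + η d^(1)_ℓ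 e_k · (g(k)/g(k−ℓ)) · v_{ℓ,k−1}, where in (iii) a term whose index ℓ−1 or k−1 would be −1 has coefficient e₀ = 0 and is absent. -/
/-- The basis vector `|ℓ,k⟩` of the space of finitely supported functions `ℕ × ℕ → ℂ`. -/
noncomputable def ket (p : ℕ × ℕ) : (ℕ × ℕ) →₀ ℂ := Finsupp.single p 1

/-- The coefficient `M^{k,ℓ}_n = ((−η)^n/n!) ∏_{j=1}^n f^(1)_{ℓ+j−1} e_{k−j+1} / g(k−ℓ−j)`,
where `e_m = m`, `f^(1)_m = 2λ₁ − m` and `g(x) = δ₁ − δ₂ + η(λ₁ − λ₂ + x)`. -/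
noncomputable def Mcoef (lam1 lam2 del1 del2 eta : ℂ) (k l n : ℕ) : ℂ :=
  ((-eta) ^ n / (n.factorial : ℂ)) *
    ∏ j ∈ Finset.Icc 1 n,
      (2 * lam1 - ((l : ℂ) + (j : ℂ) - 1)) * ((k : ℂ) - (j : ℂ) + 1) /
        (del1 - del2 + eta * (lam1 - lam2 + ((k : ℂ) - (l : ℂ) - (j : ℂ))))

/-- The twisted basis vector `v_{ℓ,k} = q_{ℓ,k} Σ_{n=0}^k M^{k,ℓ}_n |ℓ+n, k−n⟩`. -/
noncomputable def vQ (lam1 lam2 del1 del2 eta : ℂ) (q : ℕ → ℕ → ℂ) (l k : ℕ) :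
    (ℕ × ℕ) →₀ ℂ :=
  q l k • ∑ n ∈ Finset.range (k + 1), Mcoef lam1 lam2 del1 del2 eta k l n • ket (l + n, k - n)

/-- Shorthand for `g`. -/
noncomputable def gg (lam1 lam2 del1 del2 eta x : ℂ) : ℂ :=
  del1 - del2 + eta * (lam1 - lam2 + x)

lemma Mcoef_zero' (lam1 lam2 del1 del2 eta : ℂ) (k l : ℕ) :
    Mcoef lam1 lam2 del1 del2 eta k l 0 = 1 := by simp [Mcoef]

lemma Mcoef_succ' (lam1 lam2 del1 del2 eta : ℂ) (k l n : ℕ) :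
    Mcoef lam1 lam2 del1 del2 eta k l (n + 1) =
      Mcoef lam1 lam2 del1 del2 eta k l n *
        (-eta / ((n : ℂ) + 1) * ((2 * lam1 - ((l : ℂ) + n)) * ((k : ℂ) - n) /
          gg lam1 lam2 del1 del2 eta ((k : ℂ) - l - n - 1))) := by
  have h2 : (n.factorial : ℂ) ≠ 0 := by exact_mod_cast n.factorial_ne_zero
  have h3 : ((n : ℂ) + 1) ≠ 0 := by exact_mod_cast n.succ_ne_zero
  unfold Mcoef gg
  rw [Finset.prod_Icc_succ_top (by omega), Nat.factorial_succ]
  push_cast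
  have e1 : (2 * lam1 - ((l : ℂ) + ((n : ℂ) + 1) - 1)) = 2 * lam1 - ((l : ℂ) + n) := by ring
  have e2 : ((k : ℂ) - ((n : ℂ) + 1) + 1) = (k : ℂ) - n := by ring
  have e3 : (k : ℂ) - l - ((n : ℂ) + 1) = (k : ℂ) - l - n - 1 := by ring
  rw [e1, e2, e3, pow_succ]
  field_simp

lemma gg_ne {lam1 lam2 del1 del2 eta : ℂ}
    (hg : ∀ m : ℤ, del1 - del2 + eta * (lam1 - lam2 + (m : ℂ)) ≠ 0)
    (a b c : ℕ) (x : ℂ) (hx : x = (a : ℂ) - b - c) :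
    gg lam1 lam2 del1 del2 eta x ≠ 0 := by
  have := hg ((a : ℤ) - b - c)
  rw [hx]; push_cast at this; exact this

lemma S1 {lam1 lam2 del1 del2 eta : ℂ}
    (hg : ∀ m : ℤ, del1 - del2 + eta * (lam1 - lam2 + (m : ℂ)) ≠ 0) (k l n : ℕ) :
    (2 * lam1 - l) * Mcoef lam1 lam2 del1 del2 eta k (l + 1) n =
      (2 * lam1 - ((l : ℂ) + n)) * Mcoef lam1 lam2 del1 del2 eta k l n *
        (gg lam1 lam2 del1 del2 eta ((k : ℂ) - l - 1) /
          gg lam1 lam2 del1 del2 eta ((k : ℂ) - l - n - 1)) := by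
  induction n with
  | zero =>
    have h := gg_ne hg k l 1 ((k : ℂ) - l - 1) (by push_cast; ring)
    simp [Mcoef_zero', h]
  | succ n ih =>
    rw [Mcoef_succ', Mcoef_succ', ← mul_assoc, ih]
    push_cast
    have e1 : (k : ℂ) - (l + 1) - n - 1 = k - l - n - 2 := by ring
    have e2 : (k : ℂ) - l - (n + 1) - 1 = k - l - n - 2 := by ring
    rw [e1, e2]
    ring

lemma S2 {lam1 lam2 del1 del2 eta : ℂ}
    (hg : ∀ m : ℤ, del1 - del2 + eta * (lam1 - lam2 + (m : ℂ)) ≠ 0) (k l n : ℕ) :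
    Mcoef lam1 lam2 del1 del2 eta (k + 1) l (n + 1) =
      Mcoef lam1 lam2 del1 del2 eta k l n *
        (-eta / ((n : ℂ) + 1) * ((2 * lam1 - ((l : ℂ) + n)) * ((k : ℂ) + 1) /
          gg lam1 lam2 del1 del2 eta ((k : ℂ) - l))) := by
  induction n with
  | zero =>
    rw [Mcoef_succ', Mcoef_zero', Mcoef_zero']
    push_cast
    have e1 : (k : ℂ) + 1 - l - 0 - 1 = k - l := by ring
    rw [e1]; ring
  | succ n ih =>
    have h3 : ((n : ℂ) + 1) ≠ 0 := by exact_mod_cast n.succ_ne_zero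
    have h4 : ((n : ℂ) + 1 + 1) ≠ 0 := by exact_mod_cast (n + 1).succ_ne_zero
    have h := gg_ne hg k l 0 ((k : ℂ) - l) (by push_cast; ring)
    have h' := gg_ne hg k l (n + 1) ((k : ℂ) - l - n - 1) (by push_cast; ring)
    rw [Mcoef_succ', ih, Mcoef_succ' _ _ _ _ _ k]
    push_cast
    have e1 : (k : ℂ) + 1 - l - (n + 1) - 1 = k - l - n - 1 := by ring
    rw [e1]
    ring

lemma S3 {lam1 lam2 del1 del2 eta : ℂ}
    (hg : ∀ m : ℤ, del1 - del2 + eta * (lam1 - lam2 + (m : ℂ)) ≠ 0) (k l n : ℕ) :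
    Mcoef lam1 lam2 del1 del2 eta k l (n + 1) =
      Mcoef lam1 lam2 del1 del2 eta k (l + 1) n *
        (-eta / ((n : ℂ) + 1) * ((2 * lam1 - (l : ℂ)) * ((k : ℂ) - n) /
          gg lam1 lam2 del1 del2 eta ((k : ℂ) - l - 1))) := by
  have h := gg_ne hg k l 1 ((k : ℂ) - l - 1) (by push_cast; ring)
  have h' := gg_ne hg k l (n + 1) ((k : ℂ) - l - n - 1) (by push_cast; ring)
  have h3 : ((n : ℂ) + 1) ≠ 0 := by exact_mod_cast n.succ_ne_zero
  have := S1 hg k l n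
  rw [Mcoef_succ']
  field_simp at this ⊢
  linear_combination eta * ((k : ℂ) - n) * this

lemma S4 {lam1 lam2 del1 del2 eta : ℂ}
    (hg : ∀ m : ℤ, del1 - del2 + eta * (lam1 - lam2 + (m : ℂ)) ≠ 0) (k l n : ℕ) :
    ((k : ℂ) + 1) * Mcoef lam1 lam2 del1 del2 eta k l n =
      ((k : ℂ) + 1 - n) * Mcoef lam1 lam2 del1 del2 eta (k + 1) l n *
        (gg lam1 lam2 del1 del2 eta ((k : ℂ) - l) /
          gg lam1 lam2 del1 del2 eta ((k : ℂ) - l - n)) := by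
  induction n with
  | zero =>
    have h := gg_ne hg k l 0 ((k : ℂ) - l) (by push_cast; ring)
    simp [Mcoef_zero', h]
  | succ n ih =>
    rw [Mcoef_succ', Mcoef_succ', ← mul_assoc, ih]
    push_cast
    have e1 : (k : ℂ) + 1 - l - n - 1 = k - l - n := by ring
    have e2 : (k : ℂ) - l - (n + 1) = k - l - n - 1 := by ring
    rw [e1, e2]
    ring

/-- Coefficient identity for `ΔD`. -/
lemma coefD {lam1 lam2 del1 del2 eta : ℂ} (u : ℂ)
    (hg : ∀ m : ℤ, del1 - del2 + eta * (lam1 - lam2 + (m : ℂ)) ≠ 0) (k l n : ℕ) :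
    Mcoef lam1 lam2 del1 del2 eta k l n *
        (eta ^ 2 * (2 * lam1 - ((l : ℂ) + n)) * ((k : ℂ) - n)) +
      Mcoef lam1 lam2 del1 del2 eta k l (n + 1) *
        ((u - del1 - eta * (lam1 - ((l : ℂ) + (n + 1)))) *
          (u - del2 - eta * (lam2 - ((k : ℂ) - (n + 1))))) =
    ((u - del1 - eta * (lam1 - (l : ℂ))) * (u - del2 - eta * (lam2 - (k : ℂ)))) *
      Mcoef lam1 lam2 del1 del2 eta k l (n + 1) := by
  have h' := gg_ne hg k l (n + 1) ((k : ℂ) - l - n - 1) (by push_cast; ring)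
  have h3 : ((n : ℂ) + 1) ≠ 0 := by exact_mod_cast n.succ_ne_zero
  rw [Mcoef_succ']
  generalize Mcoef lam1 lam2 del1 del2 eta k l n = M
  field_simp
  unfold gg
  ring

/-- Coefficient identity for `ΔB`. -/
lemma coefB {lam1 lam2 del1 del2 eta : ℂ} (u : ℂ)
    (hg : ∀ m : ℤ, del1 - del2 + eta * (lam1 - lam2 + (m : ℂ)) ≠ 0) (k l n : ℕ) :
    Mcoef lam1 lam2 del1 del2 eta k l n *
        (eta * (2 * lam1 - ((l : ℂ) + n)) * (u - del2 + eta * (lam2 - ((k : ℂ) - n)))) +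
      Mcoef lam1 lam2 del1 del2 eta k l (n + 1) *
        (eta * (u - del1 - eta * (lam1 - ((l : ℂ) + (n + 1)))) *
          (2 * lam2 - ((k : ℂ) - (n + 1)))) =
    (eta * (2 * lam1 - (l : ℂ)) * (u - del2 - eta * (lam2 - (k : ℂ))) *
      (gg lam1 lam2 del1 del2 eta (2 * lam2 - l) * gg lam1 lam2 del1 del2 eta (-l - 1) /
        (gg lam1 lam2 del1 del2 eta (k - l) * gg lam1 lam2 del1 del2 eta (k - l - 1)))) *
      Mcoef lam1 lam2 del1 del2 eta k (l + 1) n +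
    (eta * (u - del1 - eta * (lam1 - (l : ℂ))) * (2 * lam2 - (k : ℂ))) *
      Mcoef lam1 lam2 del1 del2 eta (k + 1) l (n + 1) := by
  have h' := gg_ne hg k l (n + 1) ((k : ℂ) - l - n - 1) (by push_cast; ring)
  have h0 := gg_ne hg k l 0 ((k : ℂ) - l) (by push_cast; ring)
  have h1 := gg_ne hg k l 1 ((k : ℂ) - l - 1) (by push_cast; ring)
  have h3 : ((n : ℂ) + 1) ≠ 0 := by exact_mod_cast n.succ_ne_zero
  have hs := S1 hg k l n
  rw [Mcoef_succ', S2 hg]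
  trans (eta * (u - del2 - eta * (lam2 - (k : ℂ))) *
      (gg lam1 lam2 del1 del2 eta (2 * lam2 - l) * gg lam1 lam2 del1 del2 eta (-l - 1) /
        (gg lam1 lam2 del1 del2 eta (k - l) * gg lam1 lam2 del1 del2 eta (k - l - 1)))) *
      ((2 * lam1 - l) * Mcoef lam1 lam2 del1 del2 eta k (l + 1) n) +
    (eta * (u - del1 - eta * (lam1 - (l : ℂ))) * (2 * lam2 - (k : ℂ))) *
      (Mcoef lam1 lam2 del1 del2 eta k l n *
        (-eta / ((n : ℂ) + 1) * ((2 * lam1 - ((l : ℂ) + n)) * ((k : ℂ) + 1) /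
          gg lam1 lam2 del1 del2 eta ((k : ℂ) - l))))
  swap
  · ring
  rw [hs]
  generalize Mcoef lam1 lam2 del1 del2 eta k l n = M
  field_simp
  unfold gg
  ring

/-- Coefficient identity for `ΔC`, with `k+1`, and the first term for `l+1`. -/
lemma coefC {lam1 lam2 del1 del2 eta : ℂ} (u : ℂ)
    (hg : ∀ m : ℤ, del1 - del2 + eta * (lam1 - lam2 + (m : ℂ)) ≠ 0) (k l n : ℕ) (X : ℂ)
    (hX : (l : ℂ) * X = (l : ℂ) * (Mcoef lam1 lam2 del1 del2 eta (k + 1) l n *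
        (-eta / ((n : ℂ) + 1) * ((2 * lam1 - ((l : ℂ) - 1)) * ((k : ℂ) + 1 - n) /
          gg lam1 lam2 del1 del2 eta ((k : ℂ) + 1 - l))))) :
    Mcoef lam1 lam2 del1 del2 eta (k + 1) l n *
        (eta * (u - del1 + eta * (lam1 - ((l : ℂ) + n))) * ((k : ℂ) + 1 - n)) +
      Mcoef lam1 lam2 del1 del2 eta (k + 1) l (n + 1) *
        (eta * ((l : ℂ) + (n + 1)) * (u - del2 - eta * (lam2 - ((k : ℂ) - n)))) =
    (eta * (l : ℂ) * (u - del2 - eta * (lam2 - ((k : ℂ) + 1)))) * X +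
    (eta * (u - del1 - eta * (lam1 - (l : ℂ))) * ((k : ℂ) + 1) *
      (gg lam1 lam2 del1 del2 eta (k + 1) * gg lam1 lam2 del1 del2 eta (-2 * lam1 + k) /
        (gg lam1 lam2 del1 del2 eta (k + 1 - l) * gg lam1 lam2 del1 del2 eta (k - l)))) *
      Mcoef lam1 lam2 del1 del2 eta k l n := by
  have h' := gg_ne hg k l n ((k : ℂ) - l - n) (by push_cast; ring)
  have h0 := gg_ne hg k l 0 ((k : ℂ) - l) (by push_cast; ring)
  have h1 := gg_ne hg (k + 1) l 0 ((k : ℂ) + 1 - l) (by push_cast; ring)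
  have h3 : ((n : ℂ) + 1) ≠ 0 := by exact_mod_cast n.succ_ne_zero
  have hs := S4 hg k l n
  trans (eta * (u - del2 - eta * (lam2 - ((k : ℂ) + 1)))) * ((l : ℂ) * X) +
    (eta * (u - del1 - eta * (lam1 - (l : ℂ))) *
      (gg lam1 lam2 del1 del2 eta (k + 1) * gg lam1 lam2 del1 del2 eta (-2 * lam1 + k) /
        (gg lam1 lam2 del1 del2 eta (k + 1 - l) * gg lam1 lam2 del1 del2 eta (k - l)))) *
      (((k : ℂ) + 1) * Mcoef lam1 lam2 del1 del2 eta k l n)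
  swap
  · ring
  rw [hs, hX, Mcoef_succ']
  push_cast
  have e1 : (k : ℂ) + 1 - l - n - 1 = k - l - n := by ring
  rw [e1]
  generalize Mcoef lam1 lam2 del1 del2 eta (k + 1) l n = M
  field_simp
  unfold gg
  ring

/-- if the diagonal coefficients `q_{ℓ,k}` satisfy the recursion relations
`q_{ℓ,k} g(k−ℓ) = q_{ℓ−1,k} g(−ℓ)` and `q_{ℓ,k+1} (δ₁−δ₂+η(−λ₁−λ₂+k)) = q_{ℓ,k} g(k−ℓ)`,
then on the twisted basis `v_{ℓ,k}` the coproducts act by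
(i) `ΔD v_{ℓ,k} = d^(1)_ℓ d^(2)_k v_{ℓ,k}`;
(ii) `ΔB v_{ℓ,k} = η f^(1)_ℓ d^(2)_k (g(2λ₂−ℓ)/g(k−ℓ)) v_{ℓ+1,k}
      + η d^(1)_ℓ f^(2)_k (g(−2λ₁+k)/g(k−ℓ)) v_{ℓ,k+1}`;
(iii) `ΔC v_{ℓ,k} = η e_ℓ d^(2)_k (g(−ℓ)/g(k−ℓ)) v_{ℓ−1,k}
      + η d^(1)_ℓ e_k (g(k)/g(k−ℓ)) v_{ℓ,k−1}`. -/
theorem twisted_coproduct_action (lam1 lam2 del1 del2 eta u : ℂ) (heta : eta ≠ 0)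
    (hg : ∀ m : ℤ, del1 - del2 + eta * (lam1 - lam2 + (m : ℂ)) ≠ 0)
    (q : ℕ → ℕ → ℂ) (hq : ∀ l k : ℕ, q l k ≠ 0)
    (hq1 : ∀ l k : ℕ, 1 ≤ l →
      q l k * (del1 - del2 + eta * (lam1 - lam2 + ((k : ℂ) - (l : ℂ)))) =
        q (l - 1) k * (del1 - del2 + eta * (lam1 - lam2 - (l : ℂ))))
    (hq2 : ∀ l k : ℕ,
      q l (k + 1) * (del1 - del2 + eta * (-lam1 - lam2 + (k : ℂ))) =
        q l k * (del1 - del2 + eta * (lam1 - lam2 + ((k : ℂ) - (l : ℂ)))))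
    (ΔB ΔC ΔD : ((ℕ × ℕ) →₀ ℂ) →ₗ[ℂ] ((ℕ × ℕ) →₀ ℂ))
    (hΔB : ∀ p r : ℕ, ΔB (ket (p, r)) =
      (eta * (2 * lam1 - (p : ℂ)) * (u - del2 + eta * (lam2 - (r : ℂ)))) • ket (p + 1, r) +
        (eta * (u - del1 - eta * (lam1 - (p : ℂ))) * (2 * lam2 - (r : ℂ))) • ket (p, r + 1))
    (hΔC : ∀ p r : ℕ, ΔC (ket (p, r)) =
      (eta * (u - del1 + eta * (lam1 - (p : ℂ))) * (r : ℂ)) • ket (p, r - 1) +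
        (eta * (p : ℂ) * (u - del2 - eta * (lam2 - (r : ℂ)))) • ket (p - 1, r))
    (hΔD : ∀ p r : ℕ, ΔD (ket (p, r)) =
      (eta ^ 2 * (2 * lam1 - (p : ℂ)) * (r : ℂ)) • ket (p + 1, r - 1) +
        ((u - del1 - eta * (lam1 - (p : ℂ))) * (u - del2 - eta * (lam2 - (r : ℂ)))) •
          ket (p, r))
    (l k : ℕ) :
    ΔD (vQ lam1 lam2 del1 del2 eta q l k) =
      ((u - del1 - eta * (lam1 - (l : ℂ))) * (u - del2 - eta * (lam2 - (k : ℂ)))) •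
        vQ lam1 lam2 del1 del2 eta q l k ∧
    ΔB (vQ lam1 lam2 del1 del2 eta q l k) =
      (eta * (2 * lam1 - (l : ℂ)) * (u - del2 - eta * (lam2 - (k : ℂ))) *
          ((del1 - del2 + eta * (lam1 + lam2 - (l : ℂ))) /
            (del1 - del2 + eta * (lam1 - lam2 + ((k : ℂ) - (l : ℂ)))))) •
          vQ lam1 lam2 del1 del2 eta q (l + 1) k +
        (eta * (u - del1 - eta * (lam1 - (l : ℂ))) * (2 * lam2 - (k : ℂ)) *
            ((del1 - del2 + eta * (-lam1 - lam2 + (k : ℂ))) /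
              (del1 - del2 + eta * (lam1 - lam2 + ((k : ℂ) - (l : ℂ)))))) •
          vQ lam1 lam2 del1 del2 eta q l (k + 1) ∧
    ΔC (vQ lam1 lam2 del1 del2 eta q l k) =
      (eta * (l : ℂ) * (u - del2 - eta * (lam2 - (k : ℂ))) *
          ((del1 - del2 + eta * (lam1 - lam2 - (l : ℂ))) /
            (del1 - del2 + eta * (lam1 - lam2 + ((k : ℂ) - (l : ℂ)))))) •
          vQ lam1 lam2 del1 del2 eta q (l - 1) k +
        (eta * (u - del1 - eta * (lam1 - (l : ℂ))) * (k : ℂ) *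
            ((del1 - del2 + eta * (lam1 - lam2 + (k : ℂ))) /
              (del1 - del2 + eta * (lam1 - lam2 + ((k : ℂ) - (l : ℂ)))))) •
          vQ lam1 lam2 del1 del2 eta q l (k - 1) := by
  have hMtop : ∀ k l : ℕ, Mcoef lam1 lam2 del1 del2 eta k l (k + 1) = 0 := by
    intro k l
    rw [Mcoef_succ']; simp
  refine ⟨?_, ?_, ?_⟩
  · unfold vQ
    rw [map_smul, smul_comm]
    congr 1
    rw [map_sum, Finset.smul_sum]
    have hL : ∀ n ∈ Finset.range (k + 1),
        ΔD (Mcoef lam1 lam2 del1 del2 eta k l n • ket (l + n, k - n)) =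
        (Mcoef lam1 lam2 del1 del2 eta k l n *
          (eta ^ 2 * (2 * lam1 - ((l : ℂ) + n)) * ((k : ℂ) - n))) • ket (l + n + 1, k - n - 1) +
        (Mcoef lam1 lam2 del1 del2 eta k l n * ((u - del1 - eta * (lam1 - ((l : ℂ) + n))) *
          (u - del2 - eta * (lam2 - ((k : ℂ) - n))))) • ket (l + n, k - n) := by
      intro n hn
      have hn' : n ≤ k := by simp at hn; omega
      rw [map_smul, hΔD, smul_add, smul_smul, smul_smul]
      push_cast [Nat.cast_sub hn']
      rfl
    rw [Finset.sum_congr rfl hL, Finset.sum_add_distrib, Finset.sum_range_succ,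
      Finset.sum_range_succ' _ k, Finset.sum_range_succ' _ k]
    simp only [sub_self, mul_zero, zero_smul, add_zero, ← add_assoc, ← Finset.sum_add_distrib]
    congr 1
    · apply Finset.sum_congr rfl
      intro n hn
      rw [smul_smul, ← coefD u hg, add_smul]
      push_cast
      rfl
    · simp [Mcoef_zero', smul_smul]
  · have hqa : q (l + 1) k = q l k * (gg lam1 lam2 del1 del2 eta (-l - 1) /
        gg lam1 lam2 del1 del2 eta (k - l - 1)) := by
      have h1 := gg_ne hg k l 1 ((k : ℂ) - l - 1) (by push_cast; ring)
      have := hq1 (l + 1) k (by omega)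
      rw [← mul_div_assoc, eq_div_iff h1]
      simp only [Nat.add_sub_cancel] at this
      push_cast at this
      unfold gg
      linear_combination this
    have h0 := gg_ne hg k l 0 ((k : ℂ) - l) (by push_cast; ring)
    have hqb : (del1 - del2 + eta * (-lam1 - lam2 + (k : ℂ))) /
              (del1 - del2 + eta * (lam1 - lam2 + ((k : ℂ) - (l : ℂ)))) * q l (k + 1) = q l k := by
      have := hq2 l k
      unfold gg at h0
      rw [div_mul_eq_mul_div, div_eq_iff h0]
      linear_combination this
    have hA : (eta * (2 * lam1 - (l : ℂ)) * (u - del2 - eta * (lam2 - (k : ℂ))) *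
          ((del1 - del2 + eta * (lam1 + lam2 - (l : ℂ))) /
            (del1 - del2 + eta * (lam1 - lam2 + ((k : ℂ) - (l : ℂ)))))) * q (l + 1) k =
        q l k * (eta * (2 * lam1 - (l : ℂ)) * (u - del2 - eta * (lam2 - (k : ℂ))) *
      (gg lam1 lam2 del1 del2 eta (2 * lam2 - l) * gg lam1 lam2 del1 del2 eta (-l - 1) /
        (gg lam1 lam2 del1 del2 eta (k - l) * gg lam1 lam2 del1 del2 eta (k - l - 1)))) := by
      rw [hqa, mul_div_mul_comm]
      have e : gg lam1 lam2 del1 del2 eta (2 * lam2 - l) =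
        del1 - del2 + eta * (lam1 + lam2 - (l : ℂ)) := by unfold gg; ring
      have e2 : gg lam1 lam2 del1 del2 eta (k - l) =
        del1 - del2 + eta * (lam1 - lam2 + ((k : ℂ) - (l : ℂ))) := rfl
      rw [e, e2]; ring
    have hB : (eta * (u - del1 - eta * (lam1 - (l : ℂ))) * (2 * lam2 - (k : ℂ)) *
            ((del1 - del2 + eta * (-lam1 - lam2 + (k : ℂ))) /
              (del1 - del2 + eta * (lam1 - lam2 + ((k : ℂ) - (l : ℂ)))))) * q l (k + 1) =
        q l k * (eta * (u - del1 - eta * (lam1 - (l : ℂ))) * (2 * lam2 - (k : ℂ))) := by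
      rw [mul_assoc, hqb]; ring
    unfold vQ
    rw [map_smul, smul_smul, smul_smul, hA, hB, mul_smul (q l k), mul_smul (q l k), ← smul_add]
    congr 1
    rw [map_sum, Finset.smul_sum, Finset.smul_sum]
    have hL : ∀ n ∈ Finset.range (k + 1),
        ΔB (Mcoef lam1 lam2 del1 del2 eta k l n • ket (l + n, k - n)) =
        (Mcoef lam1 lam2 del1 del2 eta k l n *
          (eta * (2 * lam1 - ((l : ℂ) + n)) * (u - del2 + eta * (lam2 - ((k : ℂ) - n))))) •
            ket (l + n + 1, k - n) +
        (Mcoef lam1 lam2 del1 del2 eta k l n * (eta * (u - del1 - eta * (lam1 - ((l : ℂ) + n))) *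
          (2 * lam2 - ((k : ℂ) - n)))) • ket (l + n, k + 1 - n) := by
      intro n hn
      have hn' : n ≤ k := by simp at hn; omega
      rw [map_smul, hΔB, smul_add, smul_smul, smul_smul]
      push_cast [Nat.cast_sub hn']
      rw [show k + 1 - n = k - n + 1 by omega]
    have hT : ∑ n ∈ Finset.range (k + 1), (Mcoef lam1 lam2 del1 del2 eta k l n *
          (eta * (u - del1 - eta * (lam1 - ((l : ℂ) + n))) *
          (2 * lam2 - ((k : ℂ) - n)))) • ket (l + n, k + 1 - n) =
        ∑ n ∈ Finset.range (k + 1 + 1), (Mcoef lam1 lam2 del1 del2 eta k l n *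
          (eta * (u - del1 - eta * (lam1 - ((l : ℂ) + n))) *
          (2 * lam2 - ((k : ℂ) - n)))) • ket (l + n, k + 1 - n) := by
      rw [Finset.sum_range_succ _ (k + 1), hMtop]
      simp
    rw [Finset.sum_congr rfl hL, Finset.sum_add_distrib, hT,
      Finset.sum_range_succ' _ (k + 1), Finset.sum_range_succ' _ (k + 1)]
    simp only [← add_assoc, ← Finset.sum_add_distrib]
    congr 1
    · apply Finset.sum_congr rfl
      intro n hn
      rw [smul_smul, smul_smul, show l + 1 + n = l + n + 1 by omega,
        show k + 1 - (n + 1) = k - n by omega, ← add_smul, ← add_smul, ← coefB u hg]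
      push_cast
      rfl
    · simp [Mcoef_zero']
  · have hA : ∀ k : ℕ, (eta * (l : ℂ) * (u - del2 - eta * (lam2 - (k : ℂ))) *
          ((del1 - del2 + eta * (lam1 - lam2 - (l : ℂ))) /
            (del1 - del2 + eta * (lam1 - lam2 + ((k : ℂ) - (l : ℂ)))))) * q (l - 1) k =
        q l k * (eta * (l : ℂ) * (u - del2 - eta * (lam2 - (k : ℂ)))) := by
      intro k
      have h0 := gg_ne hg k l 0 ((k : ℂ) - l) (by push_cast; ring)
      unfold gg at h0
      rcases Nat.eq_zero_or_pos l with h | h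
      · subst h; simp
      · have := hq1 l k h
        have e : (del1 - del2 + eta * (lam1 - lam2 - (l : ℂ))) /
            (del1 - del2 + eta * (lam1 - lam2 + ((k : ℂ) - (l : ℂ)))) * q (l - 1) k = q l k := by
          rw [div_mul_eq_mul_div, div_eq_iff h0]
          linear_combination -this
        rw [mul_assoc, e]; ring
    rcases k with _ | k
    · unfold vQ
      rw [smul_smul, hA, map_smul]
      simp [Mcoef_zero', hΔC, smul_smul]
    have h0 := gg_ne hg k l 0 ((k : ℂ) - l) (by push_cast; ring)
    have hB : (eta * (u - del1 - eta * (lam1 - (l : ℂ))) * ((k + 1 : ℕ) : ℂ) *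
            ((del1 - del2 + eta * (lam1 - lam2 + ((k + 1 : ℕ) : ℂ))) /
              (del1 - del2 + eta * (lam1 - lam2 + (((k + 1 : ℕ) : ℂ) - (l : ℂ)))))) * q l k =
        q l (k + 1) * (eta * (u - del1 - eta * (lam1 - (l : ℂ))) * ((k : ℂ) + 1) *
      (gg lam1 lam2 del1 del2 eta (k + 1) * gg lam1 lam2 del1 del2 eta (-2 * lam1 + k) /
        (gg lam1 lam2 del1 del2 eta (k + 1 - l) * gg lam1 lam2 del1 del2 eta (k - l)))) := by
      have e : q l k = q l (k + 1) * gg lam1 lam2 del1 del2 eta (-2 * lam1 + k) /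
          gg lam1 lam2 del1 del2 eta (k - l) := by
        rw [eq_div_iff h0]
        unfold gg
        linear_combination -hq2 l k
      rw [e, mul_div_mul_comm]
      push_cast
      unfold gg
      ring
    unfold vQ
    rw [Nat.add_sub_cancel, map_smul, smul_smul, smul_smul, hA, hB, mul_smul (q l (k + 1)),
      mul_smul (q l (k + 1)),
      ← smul_add]
    congr 1
    rw [map_sum, Finset.smul_sum, Finset.smul_sum]
    have hL : ∀ n ∈ Finset.range (k + 1 + 1),
        ΔC (Mcoef lam1 lam2 del1 del2 eta (k + 1) l n • ket (l + n, k + 1 - n)) =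
        (Mcoef lam1 lam2 del1 del2 eta (k + 1) l n *
          (eta * (u - del1 + eta * (lam1 - ((l : ℂ) + n))) * ((k : ℂ) + 1 - n))) •
            ket (l + n, k - n) +
        (Mcoef lam1 lam2 del1 del2 eta (k + 1) l n * (eta * ((l : ℂ) + n) *
          (u - del2 - eta * (lam2 - ((k : ℂ) + 1 - n))))) • ket (l + n - 1, k + 1 - n) := by
      intro n hn
      have hn' : n ≤ k + 1 := by simp at hn; omega
      rw [map_smul, hΔC, smul_add, smul_smul, smul_smul]
      push_cast [Nat.cast_sub hn']
      rw [show k + 1 - n - 1 = k - n by omega]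
    rw [Finset.sum_congr rfl hL, Finset.sum_add_distrib, Finset.sum_range_succ,
      Finset.sum_range_succ' _ (k + 1), Finset.sum_range_succ' _ (k + 1)]
    have ez : (k : ℂ) + 1 - ((k + 1 : ℕ) : ℂ) = 0 := by push_cast; ring
    rw [ez]
    simp only [mul_zero, zero_smul, add_zero]
    rw [add_right_comm, ← add_assoc, ← Finset.sum_add_distrib, ← Finset.sum_add_distrib]
    congr 1
    · apply Finset.sum_congr rfl
      intro n hn
      rw [smul_smul, smul_smul, show l + (n + 1) - 1 = l + n by omega,
        show k + 1 - (n + 1) = k - n by omega, ← add_smul]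
      have hX : (l : ℂ) * Mcoef lam1 lam2 del1 del2 eta (k + 1) (l - 1) (n + 1) =
          (l : ℂ) * (Mcoef lam1 lam2 del1 del2 eta (k + 1) l n *
          (-eta / ((n : ℂ) + 1) * ((2 * lam1 - ((l : ℂ) - 1)) * ((k : ℂ) + 1 - n) /
          gg lam1 lam2 del1 del2 eta ((k : ℂ) + 1 - l)))) := by
        rcases l with _ | l
        · simp
        · rw [Nat.add_sub_cancel, S3 hg]
          push_cast
          rw [show (k : ℂ) + 1 - l - 1 = k + 1 - (l + 1) by ring,
            show (l : ℂ) + 1 - 1 = l by ring]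
      have hc := coefC u hg k l n _ hX
      have e4 : (k : ℂ) + 1 - (n + 1) = k - n := by ring
      push_cast
      rw [e4, hc, add_smul]
      congr 1
      rcases l with _ | l
      · simp
      · rw [show l + 1 - 1 + (n + 1) = l + 1 + n by omega]
    · simp [Mcoef_zero']
end

section
/- Assume g̃(m) ≠ 0 for every integer m, and let q̃ : ℕ × ℕ → ℂ be a nowhere-vanishing function satisfying the recursion relations q̃_{ℓ+1,k} · g̃(2λ₂−ℓ) = q̃_{ℓ,k} · g̃(k−ℓ) for all ℓ, k ∈ ℕ, and q̃_{ℓ,k} · g̃(k−ℓ) = q̃_{ℓ,k−1} · g̃(k) for all ℓ ∈ ℕ, k ≥ 1. Set ṽ_{ℓ,k} := q̃_{ℓ,k} · Σ_{n=0}^ℓ M̃^{k,ℓ}_n |ℓ−n, k+n⟩. Then for all ℓ, k ∈ ℕ: (i) ΔA ṽ_{ℓ,k} = a^(1)_ℓ a^(2)_k ṽ_{ℓ,k}; (ii) ΔB ṽ_{ℓ,k} = η f^(1)_ℓ a^(2)_k · (g̃(2λ₂−ℓ)/g̃(k−ℓ)) · ṽ_{ℓ+1,k} + η a^(1)_ℓ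 f^(2)_k · (g̃(−2λ₁+k)/g̃(k−ℓ)) · ṽ_{ℓ,k+1}; (iii) ΔC ṽ_{ℓ,k} = η e_ℓ a^(2)_k · (g̃(−ℓ)/g̃(k−ℓ)) · ṽ_{ℓ−1,k} + η a^(1)_ℓ e_k · (g̃(k)/g̃(k−ℓ)) · ṽ_{ℓ,k−1}, where in (iii) a term whose index ℓ−1 or k−1 would be −1 has coefficient e₀ = 0 and is absent. -/
/-- The coefficient `M̃^{k,ℓ}_n = (η^n/n!) ∏_{j=1}^n e_{ℓ−j+1} f^(2)_{k+j−1} / g̃(k−ℓ+j)`,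
where `e_m = m`, `f^(2)_m = 2λ₂ − m` and `g̃(x) = δ₂ − δ₁ + η(λ₁ − λ₂ + x)`. -/
noncomputable def Mtcoef (lam1 lam2 del1 del2 eta : ℂ) (k l n : ℕ) : ℂ :=
  (eta ^ n / (n.factorial : ℂ)) *
    ∏ j ∈ Finset.Icc 1 n,
      ((l : ℂ) - (j : ℂ) + 1) * (2 * lam2 - ((k : ℂ) + (j : ℂ) - 1)) /
        (del2 - del1 + eta * (lam1 - lam2 + ((k : ℂ) - (l : ℂ) + (j : ℂ))))

/-- The twisted basis vector `ṽ_{ℓ,k} = q̃_{ℓ,k} Σ_{n=0}^ℓ M̃^{k,ℓ}_n |ℓ−n, k+n⟩`. -/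
noncomputable def vQt (lam1 lam2 del1 del2 eta : ℂ) (qt : ℕ → ℕ → ℂ) (l k : ℕ) :
    (ℕ × ℕ) →₀ ℂ :=
  qt l k • ∑ n ∈ Finset.range (l + 1), Mtcoef lam1 lam2 del1 del2 eta k l n • ket (l - n, k + n)

lemma Mt_zero (lam1 lam2 del1 del2 eta : ℂ) (k l : ℕ) :
    Mtcoef lam1 lam2 del1 del2 eta k l 0 = 1 := by
  simp [Mtcoef]

lemma Mt_succ (lam1 lam2 del1 del2 eta : ℂ) (k l n : ℕ) :
    Mtcoef lam1 lam2 del1 del2 eta k l (n + 1) = Mtcoef lam1 lam2 del1 del2 eta k l n *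
      (eta / ((n : ℂ) + 1) * (((l : ℂ) - n) * (2 * lam2 - ((k : ℂ) + n))) /
        (del2 - del1 + eta * (lam1 - lam2 + ((k : ℂ) - l + n + 1)))) := by
  have h : ((n : ℂ) + 1) ≠ 0 := by exact_mod_cast Nat.succ_ne_zero n
  have h2 : ((n.factorial : ℕ) : ℂ) ≠ 0 := by exact_mod_cast n.factorial_ne_zero
  unfold Mtcoef
  rw [Finset.prod_Icc_succ_top (by omega), Nat.factorial_succ, pow_succ]
  push_cast
  have e1 : (l : ℂ) - (n + 1) + 1 = l - n := by ring
  have e2 : (k : ℂ) + (n + 1) - 1 = k + n := by ring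
  have e3 : (k : ℂ) - l + (n + 1) = k - l + n + 1 := by ring
  rw [e1, e2, e3]
  simp only [div_eq_mul_inv, mul_inv]
  ring

lemma Mt_top (lam1 lam2 del1 del2 eta : ℂ) (k l : ℕ) :
    Mtcoef lam1 lam2 del1 del2 eta k l (l + 1) = 0 := by
  rw [Mt_succ]; simp

lemma hg_nat {lam1 lam2 del1 del2 eta : ℂ}
    (hg : ∀ m : ℤ, del2 - del1 + eta * (lam1 - lam2 + (m : ℂ)) ≠ 0) (k l n : ℕ) :
    del2 - del1 + eta * (lam1 - lam2 + ((k : ℂ) - l + n)) ≠ 0 := by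
  have := hg ((k : ℤ) - l + n)
  push_cast at this
  exact this

lemma Mt_l (lam1 lam2 del1 del2 eta : ℂ)
    (hg : ∀ m : ℤ, del2 - del1 + eta * (lam1 - lam2 + (m : ℂ)) ≠ 0) (k l n : ℕ) :
    Mtcoef lam1 lam2 del1 del2 eta k (l + 1) (n + 1) = Mtcoef lam1 lam2 del1 del2 eta k l n *
      (eta / ((n : ℂ) + 1) * (((l : ℂ) + 1) * (2 * lam2 - ((k : ℂ) + n))) /
        (del2 - del1 + eta * (lam1 - lam2 + ((k : ℂ) - l)))) := by
  induction n with
  | zero => rw [Mt_succ, Mt_zero, Mt_zero]; push_cast; ring_nf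
  | succ n ih =>
    rw [Mt_succ, ih, Mt_succ]
    have h : ((n : ℂ) + 1) ≠ 0 := by exact_mod_cast Nat.succ_ne_zero n
    push_cast
    have e : (k : ℂ) - (l + 1) + (n + 1) + 1 = k - l + n + 1 := by ring
    rw [e]
    simp only [div_eq_mul_inv]
    ring

lemma Mt_k (lam1 lam2 del1 del2 eta : ℂ)
    (hg : ∀ m : ℤ, del2 - del1 + eta * (lam1 - lam2 + (m : ℂ)) ≠ 0) (k l n : ℕ) :
    (2 * lam2 - (k : ℂ)) * Mtcoef lam1 lam2 del1 del2 eta (k + 1) l n =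
      Mtcoef lam1 lam2 del1 del2 eta k l n * ((2 * lam2 - ((k : ℂ) + n)) *
        (del2 - del1 + eta * (lam1 - lam2 + ((k : ℂ) - l + 1))) /
        (del2 - del1 + eta * (lam1 - lam2 + ((k : ℂ) - l + n + 1)))) := by
  induction n with
  | zero =>
    have := hg_nat hg k l 1
    push_cast at this
    rw [Mt_zero, Mt_zero]; push_cast
    simp only [add_zero]
    field_simp
  | succ n ih =>
    rw [Mt_succ, ← mul_assoc, ih, Mt_succ]
    push_cast
    have e : (k : ℂ) + 1 - l + n + 1 = k - l + (n + 1) + 1 := by ring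
    rw [e]
    simp only [div_eq_mul_inv]
    ring

lemma Mt_d (lam1 lam2 del1 del2 eta : ℂ)
    (hg : ∀ m : ℤ, del2 - del1 + eta * (lam1 - lam2 + (m : ℂ)) ≠ 0) (k l n : ℕ) :
    Mtcoef lam1 lam2 del1 del2 eta k l (n + 1) = Mtcoef lam1 lam2 del1 del2 eta (k + 1) l n *
      (eta / ((n : ℂ) + 1) * (((l : ℂ) - n) * (2 * lam2 - k)) /
        (del2 - del1 + eta * (lam1 - lam2 + ((k : ℂ) - l + 1)))) := by
  have h1 := hg_nat hg k l 1
  push_cast at h1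
  have h := Mt_k lam1 lam2 del1 del2 eta hg k l n
  rw [Mt_succ]
  have : Mtcoef lam1 lam2 del1 del2 eta (k + 1) l n *
      (eta / ((n : ℂ) + 1) * (((l : ℂ) - n) * (2 * lam2 - k)) /
        (del2 - del1 + eta * (lam1 - lam2 + ((k : ℂ) - l + 1))))
      = ((2 * lam2 - (k : ℂ)) * Mtcoef lam1 lam2 del1 del2 eta (k + 1) l n) *
      (eta / ((n : ℂ) + 1) * ((l : ℂ) - n) /
        (del2 - del1 + eta * (lam1 - lam2 + ((k : ℂ) - l + 1)))) := by ring
  rw [this, h]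
  field_simp

lemma Mt_e (lam1 lam2 del1 del2 eta : ℂ)
    (hg : ∀ m : ℤ, del2 - del1 + eta * (lam1 - lam2 + (m : ℂ)) ≠ 0) (k l n : ℕ) :
    ((l : ℂ) + 1) * Mtcoef lam1 lam2 del1 del2 eta k l n =
      Mtcoef lam1 lam2 del1 del2 eta k (l + 1) n * (((l : ℂ) + 1 - n) *
        (del2 - del1 + eta * (lam1 - lam2 + ((k : ℂ) - l))) /
        (del2 - del1 + eta * (lam1 - lam2 + ((k : ℂ) - l + n)))) := by
  induction n with
  | zero =>
    have := hg_nat hg k l 0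
    push_cast at this
    rw [Mt_zero, Mt_zero]; push_cast
    simp only [add_zero] at this ⊢
    field_simp
    ring
  | succ n ih =>
    rw [Mt_succ, ← mul_assoc, ih, Mt_succ]
    push_cast
    have e : (k : ℂ) - (l + 1) + n + 1 = k - l + n := by ring
    have e' : (k : ℂ) - l + (n + 1) = k - l + n + 1 := by ring
    rw [e, e']
    simp only [div_eq_mul_inv]
    ring

lemma partA (lam1 lam2 del1 del2 eta u : ℂ)
    (hg : ∀ m : ℤ, del2 - del1 + eta * (lam1 - lam2 + (m : ℂ)) ≠ 0)
    (ΔA : ((ℕ × ℕ) →₀ ℂ) →ₗ[ℂ] ((ℕ × ℕ) →₀ ℂ))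
    (hΔA : ∀ p r : ℕ, ΔA (ket (p, r)) =
      ((u - del1 + eta * (lam1 - (p : ℂ))) * (u - del2 + eta * (lam2 - (r : ℂ)))) •
          ket (p, r) +
        (eta ^ 2 * (p : ℂ) * (2 * lam2 - (r : ℂ))) • ket (p - 1, r + 1)) (l k : ℕ) :
    ΔA (∑ n ∈ Finset.range (l + 1), Mtcoef lam1 lam2 del1 del2 eta k l n • ket (l - n, k + n)) =
      ((u - del1 + eta * (lam1 - (l : ℂ))) * (u - del2 + eta * (lam2 - (k : ℂ)))) •
      ∑ n ∈ Finset.range (l + 1), Mtcoef lam1 lam2 del1 del2 eta k l n • ket (l - n, k + n) := by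
  simp only [map_sum, map_smul, hΔA, smul_add, Finset.sum_add_distrib, Finset.smul_sum, smul_smul]
  rw [Finset.sum_range_succ', Finset.sum_range_succ (n := l), Finset.sum_range_succ' (n := l)]
  simp only [Nat.sub_self, Nat.cast_zero, mul_zero, zero_mul, zero_smul, add_zero, Nat.sub_zero,
    Mt_zero, one_mul, mul_one]
  rw [add_right_comm, ← Finset.sum_add_distrib]
  congr 1
  refine Finset.sum_congr rfl fun n hn => ?_
  have hn : n < l := Finset.mem_range.1 hn
  rw [show l - n - 1 = l - (n + 1) by omega, show k + n + 1 = k + (n + 1) by omega, ← add_smul]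
  congr 1
  rw [Mt_succ, Nat.cast_sub (by omega), Nat.cast_sub (by omega)]
  have h1 := hg_nat hg k l (n + 1)
  have h : ((n : ℂ) + 1) ≠ 0 := by exact_mod_cast Nat.succ_ne_zero n
  push_cast at h1 ⊢
  rw [← add_assoc ((k : ℂ) - l)] at h1
  generalize Mtcoef lam1 lam2 del1 del2 eta k l n = X
  clear hg hΔA
  generalize (n : ℂ) = N at *
  generalize (l : ℂ) = L at *
  generalize (k : ℂ) = K at *
  obtain ⟨D, hD⟩ : ∃ D, D = del2 - del1 + eta * (lam1 - lam2 + (K - L + N + 1)) := ⟨_, rfl⟩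
  rw [← hD] at h1 ⊢
  obtain rfl : del2 = D + del1 - eta * (lam1 - lam2 + (K - L + N + 1)) := by
    rw [hD]; ring
  clear hD
  field_simp
  ring

lemma partB (lam1 lam2 del1 del2 eta u : ℂ)
    (hg : ∀ m : ℤ, del2 - del1 + eta * (lam1 - lam2 + (m : ℂ)) ≠ 0)
    (ΔB : ((ℕ × ℕ) →₀ ℂ) →ₗ[ℂ] ((ℕ × ℕ) →₀ ℂ))
    (hΔB : ∀ p r : ℕ, ΔB (ket (p, r)) =
      (eta * (2 * lam1 - (p : ℂ)) * (u - del2 + eta * (lam2 - (r : ℂ)))) • ket (p + 1, r) +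
        (eta * (u - del1 - eta * (lam1 - (p : ℂ))) * (2 * lam2 - (r : ℂ))) • ket (p, r + 1))
    (l k : ℕ) :
    ΔB (∑ n ∈ Finset.range (l + 1), Mtcoef lam1 lam2 del1 del2 eta k l n • ket (l - n, k + n)) =
      (eta * (2 * lam1 - (l : ℂ)) * (u - del2 + eta * (lam2 - (k : ℂ)))) •
      (∑ n ∈ Finset.range (l + 1 + 1), Mtcoef lam1 lam2 del1 del2 eta k (l + 1) n •
        ket (l + 1 - n, k + n)) +
      (eta * (u - del1 + eta * (lam1 - (l : ℂ))) * (2 * lam2 - (k : ℂ)) *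
            ((del2 - del1 + eta * (-lam1 - lam2 + (k : ℂ))) /
              (del2 - del1 + eta * (lam1 - lam2 + ((k : ℂ) - (l : ℂ))))) *
            ((del2 - del1 + eta * (lam1 - lam2 + ((k : ℂ) + 1))) /
              (del2 - del1 + eta * (lam1 - lam2 + ((k : ℂ) - (l : ℂ) + 1))))) •
      ∑ n ∈ Finset.range (l + 1), Mtcoef lam1 lam2 del1 del2 eta (k + 1) l n •
        ket (l - n, k + 1 + n) := by
  simp only [map_sum, map_smul, hΔB, smul_add, Finset.sum_add_distrib, Finset.smul_sum, smul_smul]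
  rw [Finset.sum_range_succ', Finset.sum_range_succ' (n := l + 1)]
  have key : ∑ n ∈ Finset.range l, (Mtcoef lam1 lam2 del1 del2 eta k l (n + 1) *
        (eta * (2 * lam1 - ((l - (n + 1) : ℕ) : ℂ)) *
          (u - del2 + eta * (lam2 - ((k + (n + 1) : ℕ) : ℂ))))) •
        ket (l - (n + 1) + 1, k + (n + 1)) =
      ∑ n ∈ Finset.range (l + 1), (Mtcoef lam1 lam2 del1 del2 eta k l (n + 1) *
        (eta * (2 * lam1 - ((l : ℂ) - n - 1)) *
          (u - del2 + eta * (lam2 - ((k : ℂ) + n + 1))))) •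
        ket (l - n, k + n + 1) := by
    rw [Finset.sum_range_succ, Mt_top, zero_mul, zero_smul, add_zero]
    refine Finset.sum_congr rfl fun n hn => ?_
    have hn : n < l := Finset.mem_range.1 hn
    rw [show l - (n + 1) + 1 = l - n by omega, Nat.cast_sub (by omega)]
    push_cast
    rw [add_assoc k n 1]
    congr 1
    ring
  rw [key, add_right_comm, add_right_comm _ _ (Finset.sum _ _), ← Finset.sum_add_distrib,
    ← Finset.sum_add_distrib]
  congr 1
  · refine Finset.sum_congr rfl fun n hn => ?_
    have hn : n < l + 1 := Finset.mem_range.1 hn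
    rw [show l + 1 - (n + 1) = l - n by omega, show k + (n + 1) = k + n + 1 by omega,
      show k + 1 + n = k + n + 1 by omega, ← add_smul, ← add_smul]
    congr 1
    have hk := Mt_k lam1 lam2 del1 del2 eta hg k l n
    rw [Mt_l _ _ _ _ _ hg]
    generalize hY : Mtcoef lam1 lam2 del1 del2 eta (k + 1) l n = Y at hk ⊢
    have : ∀ a b c d : ℂ, a * (2 * lam2 - (k : ℂ)) * b * c * Y =
      a * b * c * ((2 * lam2 - (k : ℂ)) * Y) := by intros; ring
    rw [this (d := 0), hk, Mt_succ, Nat.cast_sub (by omega)]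
    have h0 := hg_nat hg k l 0
    have h1 := hg_nat hg k l 1
    have h2 := hg_nat hg k l (n + 1)
    have h : ((n : ℂ) + 1) ≠ 0 := by exact_mod_cast Nat.succ_ne_zero n
    push_cast at h0 h1 h2 ⊢
    rw [← add_assoc ((k : ℂ) - l)] at h2
    rw [add_zero] at h0
    generalize Mtcoef lam1 lam2 del1 del2 eta k l n = X
    clear this hk hY key hg hΔB
    generalize (n : ℂ) = N at *
    generalize (l : ℂ) = L at *
    generalize (k : ℂ) = K at *
    obtain ⟨D0, e0⟩ : ∃ D, D = del2 - del1 + eta * (lam1 - lam2 + (K - L)) := ⟨_, rfl⟩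
    obtain ⟨D1, e1⟩ : ∃ D, D = del2 - del1 + eta * (lam1 - lam2 + (K - L + 1)) := ⟨_, rfl⟩
    obtain ⟨D, e2⟩ : ∃ D, D = del2 - del1 + eta * (lam1 - lam2 + (K - L + N + 1)) := ⟨_, rfl⟩
    rw [← e0] at h0
    rw [← e1] at h1
    rw [← e2] at h2
    rw [← e0, ← e1, ← e2]
    field_simp
    rw [e0, e2]
    ring
  · simp [Mt_zero]

lemma partC (lam1 lam2 del1 del2 eta u : ℂ)
    (hg : ∀ m : ℤ, del2 - del1 + eta * (lam1 - lam2 + (m : ℂ)) ≠ 0)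
    (ΔC : ((ℕ × ℕ) →₀ ℂ) →ₗ[ℂ] ((ℕ × ℕ) →₀ ℂ))
    (hΔC : ∀ p r : ℕ, ΔC (ket (p, r)) =
      (eta * (u - del1 + eta * (lam1 - (p : ℂ))) * (r : ℂ)) • ket (p, r - 1) +
        (eta * (p : ℂ) * (u - del2 - eta * (lam2 - (r : ℂ)))) • ket (p - 1, r))
    (l k : ℕ) :
    ΔC (∑ n ∈ Finset.range (l + 1), Mtcoef lam1 lam2 del1 del2 eta k l n • ket (l - n, k + n)) =
      (eta * (l : ℂ) * (u - del2 + eta * (lam2 - (k : ℂ))) *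
          ((del2 - del1 + eta * (lam1 - lam2 - (l : ℂ))) /
            (del2 - del1 + eta * (lam1 - lam2 + ((k : ℂ) - (l : ℂ))))) *
          ((del2 - del1 + eta * (lam1 + lam2 - (l : ℂ) + 1)) /
            (del2 - del1 + eta * (lam1 - lam2 + ((k : ℂ) - (l : ℂ) + 1))))) •
      (∑ n ∈ Finset.range (l - 1 + 1), Mtcoef lam1 lam2 del1 del2 eta k (l - 1) n •
        ket (l - 1 - n, k + n)) +
      (eta * (u - del1 + eta * (lam1 - (l : ℂ))) * (k : ℂ)) •
      ∑ n ∈ Finset.range (l + 1), Mtcoef lam1 lam2 del1 del2 eta (k - 1) l n •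
        ket (l - n, k - 1 + n) := by
  rcases l with _ | l
  · simp [hΔC, Mt_zero]
  simp only [map_sum, map_smul, hΔC, smul_add, Finset.sum_add_distrib, Finset.smul_sum, smul_smul]
  rw [Finset.sum_range_succ', Finset.sum_range_succ (n := l + 1),
    Finset.sum_range_succ' (n := l + 1)]
  simp only [Nat.sub_self, Nat.cast_zero, mul_zero, zero_mul, zero_smul, add_zero, Nat.sub_zero,
    Mt_zero, one_mul, mul_one, Nat.add_sub_cancel]
  rw [add_right_comm, ← add_assoc, ← Finset.sum_add_distrib, ← Finset.sum_add_distrib]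
  congr 1
  refine Finset.sum_congr rfl fun n hn => ?_
  have hn : n < l + 1 := Finset.mem_range.1 hn
  have hk : (eta * (u - del1 + eta * (lam1 - ((l + 1 : ℕ) : ℂ))) * (k : ℂ) *
      Mtcoef lam1 lam2 del1 del2 eta (k - 1) (l + 1) (n + 1)) •
        ket (l + 1 - (n + 1), k - 1 + (n + 1)) =
      (eta * (u - del1 + eta * (lam1 - ((l + 1 : ℕ) : ℂ))) * (k : ℂ) *
      (Mtcoef lam1 lam2 del1 del2 eta k (l + 1) n *
      (eta / ((n : ℂ) + 1) * (((l : ℂ) + 1 - n) * (2 * lam2 - ((k : ℂ) - 1))) /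
        (del2 - del1 + eta * (lam1 - lam2 + ((k : ℂ) - l - 1)))))) • ket (l - n, k + n) := by
    rcases k with _ | k
    · simp
    · rw [Nat.add_sub_cancel, Mt_d _ _ _ _ _ hg, show l + 1 - (n + 1) = l - n by omega,
        show k + (n + 1) = k + 1 + n by omega]
      congr 1
      push_cast
      rw [show (k : ℂ) + 1 - 1 = k by ring, show (k : ℂ) - (l + 1) + 1 = k + 1 - l - 1 by ring]
  rw [hk, show l + 1 - (n + 1) = l - n by omega, show k + (n + 1) - 1 = k + n by omega,
    show l + 1 - n - 1 = l - n by omega, ← add_smul, ← add_smul]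
  congr 1
  have he := Mt_e lam1 lam2 del1 del2 eta hg k l n
  generalize hY : Mtcoef lam1 lam2 del1 del2 eta k l n = Y at he ⊢
  push_cast
  have : ∀ a b c d : ℂ, a * ((l : ℂ) + 1) * b * c * d * Y =
      a * b * c * d * (((l : ℂ) + 1) * Y) := by intros; ring
  rw [this, he, Mt_succ, Nat.cast_sub (by omega), Nat.cast_sub (by omega)]
  have h0 := hg_nat hg k l 0
  have h1 := hg_nat hg k (l + 1) 0
  have h2 := hg_nat hg k l n
  have h : ((n : ℂ) + 1) ≠ 0 := by exact_mod_cast Nat.succ_ne_zero n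
  push_cast at h0 h1 h2 ⊢
  rw [add_zero] at h0 h1
  generalize Mtcoef lam1 lam2 del1 del2 eta k (l + 1) n = X
  rw [show (k : ℂ) - (l + 1) + n + 1 = k - l + n by ring,
    show (k : ℂ) - (l + 1) + 1 = k - l by ring]
  rw [show (k : ℂ) - (l + 1) = k - l - 1 by ring] at h1 ⊢
  field_simp
  ring

/-- if the diagonal coefficients `q̃_{ℓ,k}` satisfy the recursion relations
`q̃_{ℓ+1,k} g̃(2λ₂−ℓ) = q̃_{ℓ,k} g̃(k−ℓ)` and `q̃_{ℓ,k} g̃(k−ℓ) = q̃_{ℓ,k−1} g̃(k)`,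
then on the twisted basis `ṽ_{ℓ,k}` the coproducts act by
(i) `ΔA ṽ_{ℓ,k} = a^(1)_ℓ a^(2)_k ṽ_{ℓ,k}`;
(ii) `ΔB ṽ_{ℓ,k} = η f^(1)_ℓ a^(2)_k (g̃(2λ₂−ℓ)/g̃(k−ℓ)) ṽ_{ℓ+1,k}
      + η a^(1)_ℓ f^(2)_k (g̃(−2λ₁+k)/g̃(k−ℓ)) ṽ_{ℓ,k+1}`;
(iii) `ΔC ṽ_{ℓ,k} = η e_ℓ a^(2)_k (g̃(−ℓ)/g̃(k−ℓ)) ṽ_{ℓ−1,k}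
      + η a^(1)_ℓ e_k (g̃(k)/g̃(k−ℓ)) ṽ_{ℓ,k−1}`. -/
theorem twisted_coproduct_action_tilde (lam1 lam2 del1 del2 eta u : ℂ) (heta : eta ≠ 0)
    (hg : ∀ m : ℤ, del2 - del1 + eta * (lam1 - lam2 + (m : ℂ)) ≠ 0)
    (qt : ℕ → ℕ → ℂ) (hqt : ∀ l k : ℕ, qt l k ≠ 0)
    (hqt1 : ∀ l k : ℕ,
      qt (l + 1) k * (del2 - del1 + eta * (lam1 + lam2 - (l : ℂ))) =
        qt l k * (del2 - del1 + eta * (lam1 - lam2 + ((k : ℂ) - (l : ℂ)))))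
    (hqt2 : ∀ l k : ℕ, 1 ≤ k →
      qt l k * (del2 - del1 + eta * (lam1 - lam2 + ((k : ℂ) - (l : ℂ)))) =
        qt l (k - 1) * (del2 - del1 + eta * (lam1 - lam2 + (k : ℂ))))
    (ΔA ΔB ΔC : ((ℕ × ℕ) →₀ ℂ) →ₗ[ℂ] ((ℕ × ℕ) →₀ ℂ))
    (hΔA : ∀ p r : ℕ, ΔA (ket (p, r)) =
      ((u - del1 + eta * (lam1 - (p : ℂ))) * (u - del2 + eta * (lam2 - (r : ℂ)))) •
          ket (p, r) +
        (eta ^ 2 * (p : ℂ) * (2 * lam2 - (r : ℂ))) • ket (p - 1, r + 1))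
    (hΔB : ∀ p r : ℕ, ΔB (ket (p, r)) =
      (eta * (2 * lam1 - (p : ℂ)) * (u - del2 + eta * (lam2 - (r : ℂ)))) • ket (p + 1, r) +
        (eta * (u - del1 - eta * (lam1 - (p : ℂ))) * (2 * lam2 - (r : ℂ))) • ket (p, r + 1))
    (hΔC : ∀ p r : ℕ, ΔC (ket (p, r)) =
      (eta * (u - del1 + eta * (lam1 - (p : ℂ))) * (r : ℂ)) • ket (p, r - 1) +
        (eta * (p : ℂ) * (u - del2 - eta * (lam2 - (r : ℂ)))) • ket (p - 1, r))
    (l k : ℕ) :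
    ΔA (vQt lam1 lam2 del1 del2 eta qt l k) =
      ((u - del1 + eta * (lam1 - (l : ℂ))) * (u - del2 + eta * (lam2 - (k : ℂ)))) •
        vQt lam1 lam2 del1 del2 eta qt l k ∧
    ΔB (vQt lam1 lam2 del1 del2 eta qt l k) =
      (eta * (2 * lam1 - (l : ℂ)) * (u - del2 + eta * (lam2 - (k : ℂ))) *
          ((del2 - del1 + eta * (lam1 + lam2 - (l : ℂ))) /
            (del2 - del1 + eta * (lam1 - lam2 + ((k : ℂ) - (l : ℂ)))))) •
          vQt lam1 lam2 del1 del2 eta qt (l + 1) k +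
        (eta * (u - del1 + eta * (lam1 - (l : ℂ))) * (2 * lam2 - (k : ℂ)) *
            ((del2 - del1 + eta * (-lam1 - lam2 + (k : ℂ))) /
              (del2 - del1 + eta * (lam1 - lam2 + ((k : ℂ) - (l : ℂ)))))) •
          vQt lam1 lam2 del1 del2 eta qt l (k + 1) ∧
    ΔC (vQt lam1 lam2 del1 del2 eta qt l k) =
      (eta * (l : ℂ) * (u - del2 + eta * (lam2 - (k : ℂ))) *
          ((del2 - del1 + eta * (lam1 - lam2 - (l : ℂ))) /
            (del2 - del1 + eta * (lam1 - lam2 + ((k : ℂ) - (l : ℂ)))))) •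
          vQt lam1 lam2 del1 del2 eta qt (l - 1) k +
        (eta * (u - del1 + eta * (lam1 - (l : ℂ))) * (k : ℂ) *
            ((del2 - del1 + eta * (lam1 - lam2 + (k : ℂ))) /
              (del2 - del1 + eta * (lam1 - lam2 + ((k : ℂ) - (l : ℂ)))))) •
          vQt lam1 lam2 del1 del2 eta qt l (k - 1) := by
  have hq : ∀ l k : ℕ, vQt lam1 lam2 del1 del2 eta qt l k = qt l k •
    ∑ n ∈ Finset.range (l + 1), Mtcoef lam1 lam2 del1 del2 eta k l n • ket (l - n, k + n) :=
    fun _ _ => rfl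
  have h0 := hg_nat hg k l 0
  have h1 := hg_nat hg k l 1
  push_cast at h0 h1
  rw [add_zero] at h0
  simp only [hq, map_smul]
  refine ⟨?_, ?_, ?_⟩
  · rw [partA _ _ _ _ _ _ hg ΔA hΔA, smul_comm]
  · rw [partB _ _ _ _ _ _ hg ΔB hΔB, smul_add]
    simp only [smul_smul]
    congr 2
    · have := hqt1 l k
      field_simp
      linear_combination -(2 * lam1 - (l : ℂ)) * (u - del2 + eta * (lam2 - (k : ℂ))) * this
    · have := hqt2 l (k + 1) (by omega)
      rw [Nat.add_sub_cancel] at this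
      push_cast at this
      rw [show (k : ℂ) + 1 - l = k - l + 1 by ring] at this
      rw [← mul_div_assoc, mul_div_assoc', eq_comm, eq_div_iff h1]
      linear_combination eta * (u - del1 + eta * (lam1 - (l : ℂ))) * (2 * lam2 - (k : ℂ)) *
            ((del2 - del1 + eta * (-lam1 - lam2 + (k : ℂ))) /
              (del2 - del1 + eta * (lam1 - lam2 + ((k : ℂ) - (l : ℂ))))) * this
  · rw [partC _ _ _ _ _ _ hg ΔC hΔC, smul_add]
    simp only [smul_smul]
    congr 2
    · rcases l with _ | l
      · simp
      · have := hqt1 l k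
        rw [Nat.add_sub_cancel]
        push_cast at h0 h1 ⊢
        rw [show (k : ℂ) - (l + 1) + 1 = k - l by ring] at h1 ⊢
        rw [show lam1 + lam2 - ((l : ℂ) + 1) + 1 = lam1 + lam2 - l by ring]
        rw [← mul_div_assoc, mul_div_assoc', div_eq_iff h1]
        linear_combination eta * ((l : ℂ) + 1) * (u - del2 + eta * (lam2 - (k : ℂ))) *
          ((del2 - del1 + eta * (lam1 - lam2 - ((l : ℂ) + 1))) /
            (del2 - del1 + eta * (lam1 - lam2 + ((k : ℂ) - ((l : ℂ) + 1))))) * this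
    · rcases k with _ | k
      · simp
      · have := hqt2 l (k + 1) (by omega)
        rw [← mul_div_assoc, div_mul_eq_mul_div, eq_div_iff h0]
        linear_combination eta * (u - del1 + eta * (lam1 - (l : ℂ))) * ((k + 1 : ℕ) : ℂ) * this
end
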